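/- arXiv:1905.00330 — 3 statements merged into one kernel-verified Lean document; each statement's English description precedes it below -/
import Mathlib

section
/- Let θ ∈ ℝ with cos(2θ) > 0, let λ = e^{iθ}, and let g ∈ ℂ satisfy g² = λ⁴ + 1. Set z = conj(λ² − 1)·g. Then Re(z) = 0 and (Im(z))² = 8·sin²θ·cos(2θ). -/
/-- For `θ` with `cos 2θ > 0`, `λ = e^{iθ}`, and `g` a square root of the
    discriminant `λ⁴ + 1`, the number `z = conj(λ² − 1)·g` satisfies `Re z = 0` and
    `(Im z)² = 8 sin²θ cos 2θ`. -/
theorem stmt_14 (θ : ℝ) (hcos : Real.cos (2 * θ) > 0)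
    (lam : ℂ) (hlam : lam = Complex.exp (θ * Complex.I))
    (g : ℂ) (hg : g ^ 2 = lam ^ 4 + 1)
    (z : ℂ) (hz : z = (starRingEnd ℂ) (lam ^ 2 - 1) * g) :
    z.re = 0 ∧ z.im ^ 2 = 8 * Real.sin θ ^ 2 * Real.cos (2 * θ) := by
  have huv : lam * (starRingEnd ℂ) lam = 1 := by
    rw [Complex.mul_conj, Complex.normSq_eq_norm_sq, hlam, Complex.norm_exp_ofReal_mul_I]
    simp
  have hsum : lam ^ 2 + (starRingEnd ℂ) lam ^ 2 = 2 * (Real.cos (2 * θ) : ℂ) := by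
    rw [← map_pow, Complex.add_conj, hlam, ← Complex.exp_nat_mul, ← Complex.exp_ofReal_mul_I_re]
    push_cast
    ring_nf
  have hsin : (Real.cos (2 * θ) : ℂ) = 1 - 2 * (Real.sin θ : ℂ) ^ 2 := by
    rw [Real.cos_two_mul, Real.cos_sq']
    push_cast
    ring
  have hsq : z ^ 2 = ((-(8 * Real.sin θ ^ 2 * Real.cos (2 * θ)) : ℝ) : ℂ) := by
    rw [hz, mul_pow, hg, map_sub, map_pow, map_one]
    push_cast [-Complex.ofReal_cos, -Complex.ofReal_sin]
    generalize (starRingEnd ℂ) lam = v at huv hsum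
    generalize (Real.cos (2 * θ) : ℂ) = C at hsum hsin ⊢
    have hC : (v ^ 2 - 1) ^ 2 * (lam ^ 4 + 1) = (2 * C) ^ 2 - 2 * (2 * C) := by
      rw [← hsum]
      have h2 : lam ^ 2 * v ^ 2 = 1 := by rw [← mul_pow, huv, one_pow]
      linear_combination (lam ^ 2 * v ^ 2 - 1 - 2 * lam ^ 2) * h2
    rw [hC]
    linear_combination 4 * C * hsin
  have hre := congrArg Complex.re hsq
  have him := congrArg Complex.im hsq
  simp only [pow_two z, Complex.mul_re, Complex.mul_im, Complex.ofReal_re,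
    Complex.ofReal_im] at hre him
  have hr : 0 ≤ 8 * Real.sin θ ^ 2 * Real.cos (2 * θ) := by positivity
  have hzre : z.re = 0 := by
    rcases mul_eq_zero.mp (show z.re * z.im = 0 by linarith) with h | h
    · exact h
    · rw [h] at hre
      nlinarith [sq_nonneg z.re]
  refine ⟨hzre, ?_⟩
  rw [hzre] at hre
  linarith
end

section
/- Let θ ∈ ℝ with cos(2θ) < 0, let λ = e^{iθ}, and let g ∈ ℂ satisfy g² = λ⁴ + 1. Set z = conj(λ² − 1)·g. Then Im(z) = 0 and (Re(z))² = −8·sin²θ·cos(2θ). -/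
/-- For `θ` with `cos 2θ < 0`, `λ = e^{iθ}`, and `g` a square root of the
    discriminant `λ⁴ + 1`, the number `z = conj(λ² − 1)·g` satisfies `Im z = 0` and
    `(Re z)² = −8 sin²θ cos 2θ`. -/
theorem stmt_15 (θ : ℝ) (hcos : Real.cos (2 * θ) < 0)
    (lam : ℂ) (hlam : lam = Complex.exp (θ * Complex.I))
    (g : ℂ) (hg : g ^ 2 = lam ^ 4 + 1)
    (z : ℂ) (hz : z = (starRingEnd ℂ) (lam ^ 2 - 1) * g) :
    z.im = 0 ∧ z.re ^ 2 = -8 * Real.sin θ ^ 2 * Real.cos (2 * θ) := by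
  set c := Real.cos θ with hc
  set s := Real.sin θ with hs
  have hlam' : lam = c + s * Complex.I := by
    rw [hlam, Complex.exp_mul_I, hc, hs, Complex.ofReal_cos, Complex.ofReal_sin]
  have hconj : (starRingEnd ℂ) lam = c - s * Complex.I := by
    simp [hlam', sub_eq_add_neg]
  have hcs : (c : ℂ) ^ 2 + (s : ℂ) ^ 2 = 1 := by
    exact_mod_cast Real.cos_sq_add_sin_sq θ
  have hcos2 : Real.cos (2 * θ) = c ^ 2 - s ^ 2 := Real.cos_two_mul' θ
  have hunit : (starRingEnd ℂ) lam * lam = 1 := by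
    rw [hconj, hlam']
    linear_combination hcs - (s : ℂ) ^ 2 * Complex.I_sq
  have hfactor : (starRingEnd ℂ) (lam ^ 2 - 1) = -2 * s * Complex.I * (starRingEnd ℂ) lam := by
    have hdiff : (starRingEnd ℂ) lam - lam = -2 * s * Complex.I := by
      rw [hconj, hlam']
      ring
    rw [map_sub, map_pow, map_one]
    linear_combination (starRingEnd ℂ) lam * hdiff + hunit
  have hdisc : lam ^ 4 + 1 = 2 * ((c : ℂ) ^ 2 - (s : ℂ) ^ 2) * lam ^ 2 := by
    have hsum : lam ^ 2 + (starRingEnd ℂ) lam ^ 2 = 2 * ((c : ℂ) ^ 2 - (s : ℂ) ^ 2) := by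
      rw [hconj, hlam']
      linear_combination 2 * (s : ℂ) ^ 2 * Complex.I_sq
    linear_combination lam ^ 2 * hsum - ((starRingEnd ℂ) lam * lam + 1) * hunit
  have hsq : z ^ 2 = ((-8 * s ^ 2 * Real.cos (2 * θ) : ℝ) : ℂ) := by
    rw [hz, mul_pow, hg, hfactor, hdisc, hcos2]
    push_cast
    linear_combination 8 * (s : ℂ) ^ 2 * ((c : ℂ) ^ 2 - (s : ℂ) ^ 2) *
      (((starRingEnd ℂ) lam * lam) ^ 2 * Complex.I_sq - ((starRingEnd ℂ) lam * lam + 1) * hunit)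
  have hre : z.re ^ 2 - z.im ^ 2 = -8 * s ^ 2 * Real.cos (2 * θ) := by
    have h := congrArg Complex.re hsq
    rw [Complex.ofReal_re, sq, Complex.mul_re] at h
    linarith
  have him : z.re * z.im = 0 := by
    have h := congrArg Complex.im hsq
    rw [Complex.ofReal_im, sq, Complex.mul_im] at h
    linarith
  have him0 : z.im = 0 := by
    rcases mul_eq_zero.mp him with h | h
    · rw [h] at hre
      have : 0 ≤ s ^ 2 * -Real.cos (2 * θ) := mul_nonneg (sq_nonneg s) (by linarith)
      exact pow_eq_zero_iff two_ne_zero |>.mp (by nlinarith [sq_nonneg z.im])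
    · exact h
  refine ⟨him0, ?_⟩
  rw [← hre, him0]
  ring
end

section
/- Let C = [[c₁₁,c₁₂],[c₂₁,c₂₂]] be a 2×2 unitary matrix with c₁₁ ≠ 0 and c₂₂ ≠ 0, and let λ ∈ ℂ with λ ≠ 0. Define the transfer matrix T⁺(C) = [[(λ² − c₁₂c₂₁)/(c₁₁λ), −c₁₂c₂₂/(c₁₁λ)],[c₂₁/λ, c₂₂/λ]]. Then for every Ψ : ℤ → ℂ × ℂ, the eigenvalue equation U_C Ψ = λΨ holds if and only if Ψ(x) = T⁺(C)·Ψ(x−1) for all x ∈ ℤ (viewing Ψ(x) as a column vector). -/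
/-- Solving the one-step relations of the walk for the left and right amplitudes at the next site. -/
theorem walk_step_iff_transfer {K : Type*} [Field K] {a b c d z : K} (ha : a ≠ 0) (hz : z ≠ 0)
    (l r l' r' : K) :
    (z * l = a * l' + b * r' ∧ z * r' = c * l + d * r) ↔
      ![l', r'] = (Matrix.of ![![(z ^ 2 - b * c) / (a * z), -(b * d) / (a * z)],
        ![c / z, d / z]]).mulVec ![l, r] := by
  have hr : r' = c / z * l + d / z * r ↔ z * r' = c * l + d * r := by
    field_simp
  have hl : l' = (z ^ 2 - b * c) / (a * z) * l + -(b * d) / (a * z) * r ↔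
      a * z * l' = (z ^ 2 - b * c) * l - b * d * r := by
    field_simp
    ring_nf
  have hv : ![l', r'] = (Matrix.of ![![(z ^ 2 - b * c) / (a * z), -(b * d) / (a * z)],
      ![c / z, d / z]]).mulVec ![l, r] ↔
      l' = (z ^ 2 - b * c) / (a * z) * l + -(b * d) / (a * z) * r ∧
        r' = c / z * l + d / z * r := by
    simp [funext_iff, Fin.forall_fin_two, mul_comm]
  rw [hv, hl, hr]
  constructor
  · rintro ⟨h₁, h₂⟩
    exact ⟨by linear_combination (-z) * h₁ - b * h₂, h₂⟩
  · rintro ⟨h₁, h₂⟩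
    exact ⟨mul_left_cancel₀ hz (by linear_combination -h₁ - b * h₂), h₂⟩

/-- For a unitary coin `C` with `c₁₁ ≠ 0`, `c₂₂ ≠ 0` and `λ ≠ 0`, the
    eigenvalue equation `U_C Ψ = λΨ` holds iff `Ψ(x) = T⁺(C) Ψ(x−1)` for all `x`, where
    `T⁺(C)` is the transfer matrix. -/
theorem stmt_18 (c11 c12 c21 c22 : ℂ)
    (hC : (Matrix.of ![![c11, c12], ![c21, c22]]) ∈ Matrix.unitaryGroup (Fin 2) ℂ)
    (hc11 : c11 ≠ 0) (hc22 : c22 ≠ 0)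
    (lam : ℂ) (hlam : lam ≠ 0)
    (T : Matrix (Fin 2) (Fin 2) ℂ)
    (hT : T = Matrix.of ![![(lam ^ 2 - c12 * c21) / (c11 * lam), -(c12 * c22) / (c11 * lam)],
                          ![c21 / lam, c22 / lam]])
    (Ψ : ℤ → ℂ × ℂ) :
    (∀ x : ℤ,
      lam * (Ψ x).1 = c11 * (Ψ (x + 1)).1 + c12 * (Ψ (x + 1)).2 ∧
      lam * (Ψ x).2 = c21 * (Ψ (x - 1)).1 + c22 * (Ψ (x - 1)).2) ↔
    (∀ x : ℤ, ![(Ψ x).1, (Ψ x).2] = T.mulVec ![(Ψ (x - 1)).1, (Ψ (x - 1)).2]) := by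
  subst hT
  simp only [← walk_step_iff_transfer hc11 hlam]
  constructor
  · intro h x
    exact ⟨by simpa using (h (x - 1)).1, (h x).2⟩
  · intro h x
    exact ⟨by simpa using (h (x + 1)).1, (h x).2⟩
end
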